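/- Let $n\ge 2$ and $\frac12 < s < \frac n2$. Then there is a constant $C$ such that for every radial Schwartz function $f$ on $\mathbb{R}^n$ and every $x\ne 0$, $|x|^{\,n/2-s}\,|f(x)| \le C\, \|f\|_{\dot H^s(\mathbb{R}^n)}$. -/

import Mathlib

open MeasureTheory FourierTransform

/-- Homogeneous Sobolev norm `‖f‖_{Ḣˢ} = ( ∫ |ξ|^{2s} |𝓕f(ξ)|² dξ )^{1/2}`. -/
noncomputable def homSobolevNorm (n : ℕ) (s : ℝ)
    (f : EuclideanSpace ℝ (Fin n) → ℂ) : ℝ :=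
  (∫ ξ : EuclideanSpace ℝ (Fin n), ‖ξ‖ ^ (2 * s) * ‖𝓕 f ξ‖ ^ 2) ^ ((1 : ℝ) / 2)

namespace RadialTrace
open scoped ComplexConjugate RealInnerProductSpace ENNReal

lemma gauss_energy {n : ℕ} (μ : Measure (EuclideanSpace ℝ (Fin n))) [IsFiniteMeasure μ]
    {b : ℝ} (hb : 0 < b) :
    ∫ ξ : EuclideanSpace ℝ (Fin n), Real.exp (-b * ‖ξ‖ ^ 2) * ‖charFun μ ξ‖ ^ 2 =
      ∫ z, (Real.pi / b) ^ ((n : ℝ) / 2) * Real.exp (-‖z.1 - z.2‖ ^ 2 / (4 * b)) ∂(μ.prod μ) := by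
  have h1 : ∀ ξ : EuclideanSpace ℝ (Fin n),
      ((Real.exp (-b * ‖ξ‖ ^ 2) * ‖charFun μ ξ‖ ^ 2 : ℝ) : ℂ) =
      ∫ z, Complex.exp (-(b : ℂ) * ‖ξ‖ ^ 2 + Complex.I * ⟪z.1 - z.2, ξ⟫) ∂(μ.prod μ) := by
    intro ξ
    have h2 : ((‖charFun μ ξ‖ ^ 2 : ℝ) : ℂ) = charFun μ ξ * charFun μ (-ξ) := by
      rw [charFun_neg, Complex.mul_conj, Complex.normSq_eq_norm_sq]
    rw [Complex.ofReal_mul, h2, charFun_apply, charFun_apply, ← integral_prod_mul,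
      ← integral_const_mul]
    congr 1
    ext z
    rw [Complex.ofReal_exp, ← Complex.exp_add, ← Complex.exp_add]
    congr 1
    simp only [inner_neg_right, inner_sub_left]
    push_cast
    ring
  have hint : Integrable (fun p : EuclideanSpace ℝ (Fin n) ×
        (EuclideanSpace ℝ (Fin n) × EuclideanSpace ℝ (Fin n)) =>
      Complex.exp (-(b : ℂ) * ‖p.1‖ ^ 2 + Complex.I * ⟪p.2.1 - p.2.2, p.1⟫))
      (volume.prod (μ.prod μ)) := by
    have hg : Integrable (fun v : EuclideanSpace ℝ (Fin n) => Real.exp (-b * ‖v‖ ^ 2)) := by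
      have := (GaussianFourier.integrable_cexp_neg_mul_sq_norm_add (V := EuclideanSpace ℝ (Fin n))
        (b := (b : ℂ)) (by simpa using hb) 0 0).norm
      refine this.congr (Filter.Eventually.of_forall fun v => ?_)
      simp only [zero_mul, add_zero]
      rw [Complex.norm_exp]
      congr 1
      have : (-(b : ℂ) * (‖v‖ : ℂ) ^ 2) = ((-b * ‖v‖ ^ 2 : ℝ) : ℂ) := by push_cast; ring
      rw [this, Complex.ofReal_re]
    have h3 := hg.mul_prod (integrable_const (1 : ℝ) (μ := μ.prod μ))
    refine h3.mono' ?_ (Filter.Eventually.of_forall fun p => ?_)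
    · apply Continuous.aestronglyMeasurable
      fun_prop
    · rw [Complex.norm_exp]
      apply le_of_eq
      rw [mul_one]
      congr 1
      have : (-(b : ℂ) * (‖p.1‖ : ℂ) ^ 2) = ((-b * ‖p.1‖ ^ 2 : ℝ) : ℂ) := by push_cast; ring
      rw [this, Complex.add_re, Complex.ofReal_re]
      simp
  rw [← Complex.ofReal_inj, ← integral_complex_ofReal, ← integral_complex_ofReal]
  simp_rw [h1]
  rw [integral_integral_swap hint]
  congr 1
  ext z
  rw [GaussianFourier.integral_cexp_neg_mul_sq_norm_add (by simpa using hb)]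
  rw [Complex.ofReal_mul, Complex.ofReal_exp, Complex.ofReal_cpow (by positivity)]
  simp

/-- surface measure pushed to the ambient space -/
noncomputable def sig (n : ℕ) : Measure (EuclideanSpace ℝ (Fin n)) :=
  (volume : Measure (EuclideanSpace ℝ (Fin n))).toSphere.map Subtype.val

instance (n : ℕ) : IsFiniteMeasure (sig n) := by unfold sig; infer_instance

lemma lintegral_polar {n : ℕ} (F : EuclideanSpace ℝ (Fin n) → ℝ≥0∞)
    (hF : Measurable F) [Nontrivial (EuclideanSpace ℝ (Fin n))] :
    ∫⁻ y, F y = ∫⁻ w, (∫⁻ r in Set.Ioi (0 : ℝ),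
      ENNReal.ofReal (r ^ (n - 1)) * F (r • w)) ∂(sig n) := by
  calc ∫⁻ y, F y = ∫⁻ x : ({(0)}ᶜ : Set (EuclideanSpace ℝ (Fin n))), F x.1 ∂(volume.comap Subtype.val) := by
        rw [lintegral_subtype_comap (measurableSet_singleton _).compl,
          restrict_compl_singleton]
    _ = ∫⁻ x, F (x.2.1 • x.1.1) ∂(volume : Measure (EuclideanSpace ℝ (Fin n))).toSphere.prod
          (.volumeIoiPow (n - 1)) := by
        have := (volume : Measure (EuclideanSpace ℝ
          (Fin n))).measurePreserving_homeomorphUnitSphereProd.lintegral_comp_emb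
          (Homeomorph.measurableEmbedding _) (fun x => F (x.2.1 • x.1.1))
        rw [finrank_euclideanSpace_fin] at this
        rw [← this]
        congr 1
        ext x
        congr 1
        have hx : ‖x.1‖ ≠ 0 := norm_ne_zero_iff.2 x.2
        simp [smul_smul, hx]
    _ = _ := by
        rw [lintegral_prod _ (by fun_prop), sig, lintegral_map]
        · congr 1
          ext w
          rw [Measure.volumeIoiPow, lintegral_withDensity_eq_lintegral_mul _ (by fun_prop) (by fun_prop),
            ← lintegral_subtype_comap measurableSet_Ioi]
          rfl
        · apply Measurable.lintegral_prod_right'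
            (f := fun p : EuclideanSpace ℝ (Fin n) × ℝ => ENNReal.ofReal (p.2 ^ (n - 1)) * F (p.2 • p.1))
          fun_prop
        · fun_prop

lemma sig_ae (n : ℕ) : ∀ᵐ w ∂(sig n), ‖w‖ = 1 := by
  rw [sig, ae_map_iff (by fun_prop) (measurableSet_eq_fun (by fun_prop) (by fun_prop))]
  exact Filter.Eventually.of_forall fun w => by simp

lemma gauss_lint {n : ℕ} {b : ℝ} (hb : 0 < b) (w : EuclideanSpace ℝ (Fin n)) :
    ∫⁻ y, ENNReal.ofReal (Real.exp (-b * ‖y - w‖ ^ 2)) =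
      ENNReal.ofReal ((Real.pi / b) ^ ((n : ℝ) / 2)) := by
  rw [lintegral_sub_right_eq_self (fun y => ENNReal.ofReal (Real.exp (-b * ‖y‖ ^ 2))) w]
  have h := GaussianFourier.integral_rexp_neg_mul_sq_norm (V := EuclideanSpace ℝ (Fin n)) hb
  rw [finrank_euclideanSpace_fin] at h
  rw [← h, ofReal_integral_eq_lintegral_ofReal]
  · by_contra hc
    rw [integral_undef hc] at h
    have : 0 < (Real.pi / b) ^ ((n : ℝ) / 2) := by positivity
    linarith
  · exact Filter.Eventually.of_forall fun _ => by positivity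

lemma sphere_bound {n : ℕ} [Nontrivial (EuclideanSpace ℝ (Fin n))] {b : ℝ} (hb : 0 < b)
    (w : EuclideanSpace ℝ (Fin n)) :
    ENNReal.ofReal (Real.sqrt b) * ∫⁻ y, ENNReal.ofReal (Real.exp (-‖w - y‖ ^ 2 / (4 * b))) ∂(sig n)
      ≤ ENNReal.ofReal (Real.exp (1/4) * (8 * Real.pi * b) ^ ((n : ℝ) / 2)) := by
  have h1 : ENNReal.ofReal (Real.exp (1/4) * (8 * Real.pi * b) ^ ((n : ℝ) / 2)) =
      ∫⁻ y, ENNReal.ofReal (Real.exp (1/4)) *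
        ENNReal.ofReal (Real.exp (-(1 / (8 * b)) * ‖y - w‖ ^ 2)) := by
    rw [lintegral_const_mul _ (by fun_prop), gauss_lint (by positivity),
      ENNReal.ofReal_mul (by positivity)]
    congr 3
    field_simp
  rw [h1, lintegral_polar _ (by fun_prop), ← lintegral_const_mul _ (by fun_prop)]
  apply lintegral_mono_ae
  filter_upwards [sig_ae n] with y hy
  have hvol : ENNReal.ofReal (Real.sqrt b) = volume (Set.Ioo (1 : ℝ) (1 + Real.sqrt b)) := by
    simp
  rw [mul_comm, hvol, ← setLIntegral_const]
  refine le_trans ?_ (lintegral_mono_set (s := Set.Ioo (1 : ℝ) (1 + Real.sqrt b)) ?_)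
  · apply setLIntegral_mono' measurableSet_Ioo
    intro r hr
    have hr1 : (1 : ℝ) ≤ r ^ (n - 1) := one_le_pow₀ hr.1.le
    rw [← ENNReal.ofReal_mul (by positivity), ← ENNReal.ofReal_mul (by have := hr.1; positivity)]
    apply ENNReal.ofReal_le_ofReal
    refine le_trans ?_ (le_mul_of_one_le_left (by positivity) hr1)
    rw [← Real.exp_add]
    apply Real.exp_le_exp.2
    have h3 : ‖r • y - w‖ ≤ ‖w - y‖ + Real.sqrt b := by
      have : r • y - w = (r - 1) • y - (w - y) := by rw [sub_smul, one_smul]; abel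
      rw [this]
      refine (norm_sub_le _ _).trans ?_
      rw [norm_smul, hy, mul_one, Real.norm_eq_abs, abs_of_pos (by linarith [hr.1])]
      linarith [hr.2]
    have h4 : ‖r • y - w‖ ^ 2 ≤ 2 * ‖w - y‖ ^ 2 + 2 * b := by
      have h5 : ‖r • y - w‖ ^ 2 ≤ (‖w - y‖ + Real.sqrt b) ^ 2 := by gcongr
      nlinarith [sq_nonneg (‖w - y‖ - Real.sqrt b), Real.sq_sqrt hb.le]
    have : 1/4 + -(1 / (8 * b)) * ‖r • y - w‖ ^ 2 - -‖w - y‖ ^ 2 / (4 * b) =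
      (2 * ‖w - y‖ ^ 2 + 2 * b - ‖r • y - w‖ ^ 2) / (8 * b) := by
      field_simp
      ring
    have h6 : 0 ≤ (2 * ‖w - y‖ ^ 2 + 2 * b - ‖r • y - w‖ ^ 2) / (8 * b) := by
      apply div_nonneg <;> linarith
    linarith
  · intro r hr
    exact lt_trans one_pos hr.1

lemma energy_integrable {n : ℕ} (μ : Measure (EuclideanSpace ℝ (Fin n))) [IsFiniteMeasure μ]
    {b : ℝ} (hb : 0 < b) :
    Integrable (fun ξ : EuclideanSpace ℝ (Fin n) =>
      Real.exp (-b * ‖ξ‖ ^ 2) * ‖charFun μ ξ‖ ^ 2) := by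
  have hg : Integrable (fun v : EuclideanSpace ℝ (Fin n) => Real.exp (-b * ‖v‖ ^ 2)) := by
    by_contra hc
    have h := GaussianFourier.integral_rexp_neg_mul_sq_norm (V := EuclideanSpace ℝ (Fin n)) hb
    rw [integral_undef hc] at h
    have : 0 < (Real.pi / b) ^ ((Module.finrank ℝ (EuclideanSpace ℝ (Fin n)) : ℝ) / 2) := by
      positivity
    linarith
  refine hg.mul_bdd (c := (μ.real Set.univ) ^ 2) ?_ (Filter.Eventually.of_forall fun ξ => ?_)
  · exact (measurable_charFun.norm.pow_const 2).aestronglyMeasurable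
  · rw [Real.norm_eq_abs, abs_of_nonneg (by positivity)]
    gcongr
    exact norm_charFun_le ξ

lemma energy_bounds {n : ℕ} [Nontrivial (EuclideanSpace ℝ (Fin n))] :
    ∃ A B : ℝ, ∀ b : ℝ, 0 < b →
      (∫ ξ : EuclideanSpace ℝ (Fin n), Real.exp (-b * ‖ξ‖ ^ 2) * ‖charFun (sig n) ξ‖ ^ 2
        ≤ A * b ^ (-(1/2) : ℝ)) ∧
      (∫ ξ : EuclideanSpace ℝ (Fin n), Real.exp (-b * ‖ξ‖ ^ 2) * ‖charFun (sig n) ξ‖ ^ 2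
        ≤ B * b ^ (-((n : ℝ) / 2))) := by
  set M := (sig n).real Set.univ with hM
  refine ⟨(8 * Real.pi ^ 2) ^ ((n : ℝ) / 2) * Real.exp (1/4) * M,
    Real.pi ^ ((n : ℝ) / 2) * ((sig n).prod (sig n)).real Set.univ, fun b hb => ⟨?_, ?_⟩⟩
  · rw [gauss_energy _ hb, integral_const_mul]
    have hI : ∫ z, Real.exp (-‖z.1 - z.2‖ ^ 2 / (4 * b)) ∂((sig n).prod (sig n)) ≤
        Real.exp (1/4) * (8 * Real.pi * b) ^ ((n : ℝ) / 2) / Real.sqrt b * M := by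
      have hsq : 0 < Real.sqrt b := Real.sqrt_pos.2 hb
      rw [integral_eq_lintegral_of_nonneg_ae (Filter.Eventually.of_forall fun _ => by positivity)
        (Continuous.aestronglyMeasurable (by fun_prop))]
      apply ENNReal.toReal_le_of_le_ofReal (by positivity)
      rw [lintegral_prod _ (by fun_prop)]
      calc _ ≤ ∫⁻ _, ENNReal.ofReal (Real.exp (1/4) * (8 * Real.pi * b) ^ ((n : ℝ) / 2) / Real.sqrt b)
              ∂(sig n) := by
            apply lintegral_mono
            intro w
            have := sphere_bound hb w
            rw [ENNReal.ofReal_div_of_pos hsq]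
            rw [ENNReal.le_div_iff_mul_le (by simp [hsq]) (by simp), mul_comm]
            exact this
        _ = _ := by
            rw [lintegral_const, ENNReal.ofReal_mul (by positivity), hM, ofReal_measureReal]
    calc _ ≤ (Real.pi / b) ^ ((n : ℝ) / 2) *
          (Real.exp (1/4) * (8 * Real.pi * b) ^ ((n : ℝ) / 2) / Real.sqrt b * M) := by gcongr
      _ = ((Real.pi / b) ^ ((n : ℝ) / 2) * (8 * Real.pi * b) ^ ((n : ℝ) / 2)) * Real.exp (1/4) * M
            * (Real.sqrt b)⁻¹ := by ring
      _ = _ := by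
        rw [← Real.mul_rpow (by positivity) (by positivity), Real.rpow_neg hb.le, Real.sqrt_eq_rpow]
        congr 4
        field_simp
  · rw [gauss_energy _ hb, integral_const_mul, Real.div_rpow (by positivity) hb.le,
      Real.rpow_neg hb.le, div_eq_mul_inv]
    have hI : ∫ z, Real.exp (-‖z.1 - z.2‖ ^ 2 / (4 * b)) ∂((sig n).prod (sig n)) ≤
        ((sig n).prod (sig n)).real Set.univ := by
      calc _ ≤ ∫ z, (1 : ℝ) ∂((sig n).prod (sig n)) := by
            apply integral_mono_of_nonneg (Filter.Eventually.of_forall fun _ => by positivity)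
              (integrable_const _) (Filter.Eventually.of_forall fun z => ?_)
            apply Real.exp_le_one_iff.2
            rw [neg_div]
            have : 0 ≤ ‖z.1 - z.2‖ ^ 2 / (4 * b) := by positivity
            linarith
        _ = _ := by simp
    calc _ ≤ Real.pi ^ ((n : ℝ) / 2) * (b ^ ((n : ℝ) / 2))⁻¹ *
          ((sig n).prod (sig n)).real Set.univ := by gcongr
      _ = _ := by ring

lemma weight_integrable {n : ℕ} [Nontrivial (EuclideanSpace ℝ (Fin n))] {s : ℝ} (hs1 : 1 / 2 < s)
    (hs2 : s < (n : ℝ) / 2) :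
    Integrable (fun ξ : EuclideanSpace ℝ (Fin n) => ‖ξ‖ ^ (-(2 * s)) * ‖charFun (sig n) ξ‖ ^ 2) := by
  have hs0 : 0 < s := by linarith
  have hG := Real.Gamma_pos_of_pos hs0
  have hcm : Measurable (fun ξ : EuclideanSpace ℝ (Fin n) => charFun (sig n) ξ) := measurable_charFun
  suffices h : Integrable (fun ξ : EuclideanSpace ℝ (Fin n) =>
      Real.Gamma s * (‖ξ‖ ^ (-(2 * s)) * ‖charFun (sig n) ξ‖ ^ 2)) by
    have := h.const_mul (Real.Gamma s)⁻¹
    refine this.congr (Filter.Eventually.of_forall fun ξ => ?_)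
    simp only
    field_simp
  refine ⟨Measurable.aestronglyMeasurable (by fun_prop), ?_⟩
  rw [hasFiniteIntegral_iff_ofReal (Filter.Eventually.of_forall fun _ => by positivity)]
  obtain ⟨A, B, hAB⟩ := energy_bounds (n := n)
  have hG0 : ∀ t, 0 < t → (∫ ξ : EuclideanSpace ℝ (Fin n),
      Real.exp (-t * ‖ξ‖ ^ 2) * ‖charFun (sig n) ξ‖ ^ 2) =
      (∫⁻ ξ : EuclideanSpace ℝ (Fin n),
      ENNReal.ofReal (Real.exp (-t * ‖ξ‖ ^ 2) * ‖charFun (sig n) ξ‖ ^ 2)).toReal := fun t ht =>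
    integral_eq_lintegral_of_nonneg_ae (Filter.Eventually.of_forall fun _ => by positivity)
      (energy_integrable _ ht).1
  have hstep : ∀ t, 0 < t → ∫⁻ ξ : EuclideanSpace ℝ (Fin n),
      ENNReal.ofReal (t ^ (s - 1) * Real.exp (-t * ‖ξ‖ ^ 2) * ‖charFun (sig n) ξ‖ ^ 2) =
      ENNReal.ofReal (t ^ (s - 1) * ∫ ξ : EuclideanSpace ℝ (Fin n),
      Real.exp (-t * ‖ξ‖ ^ 2) * ‖charFun (sig n) ξ‖ ^ 2) := by
    intro t ht
    rw [← integral_const_mul, ofReal_integral_eq_lintegral_ofReal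
      ((energy_integrable _ ht).const_mul _) (Filter.Eventually.of_forall fun _ => by positivity)]
    simp only [mul_assoc]
  have hptw : ∀ᵐ ξ : EuclideanSpace ℝ (Fin n),
      ENNReal.ofReal (Real.Gamma s * (‖ξ‖ ^ (-(2 * s)) * ‖charFun (sig n) ξ‖ ^ 2)) =
      ∫⁻ t in Set.Ioi (0 : ℝ),
        ENNReal.ofReal (t ^ (s - 1) * Real.exp (-t * ‖ξ‖ ^ 2) * ‖charFun (sig n) ξ‖ ^ 2) := by
    have h0 : ∀ᵐ ξ : EuclideanSpace ℝ (Fin n), ξ ≠ 0 := by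
      simp [ae_iff]
    filter_upwards [h0] with ξ hξ
    have hp : 0 < ‖ξ‖ := norm_pos_iff.2 hξ
    have hgam := Real.integral_rpow_mul_exp_neg_mul_Ioi hs0 (r := ‖ξ‖ ^ 2) (by positivity)
    have hint : IntegrableOn (fun t : ℝ => t ^ (s - 1) * Real.exp (-(‖ξ‖ ^ 2 * t))) (Set.Ioi 0) := by
      by_contra hc
      rw [integral_undef hc] at hgam
      have : 0 < (1 / ‖ξ‖ ^ 2) ^ s * Real.Gamma s := by positivity
      linarith
    have e1 : Real.Gamma s * (‖ξ‖ ^ (-(2 * s)) * ‖charFun (sig n) ξ‖ ^ 2) =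
        ∫ t in Set.Ioi (0 : ℝ), t ^ (s - 1) * Real.exp (-(‖ξ‖ ^ 2 * t)) * ‖charFun (sig n) ξ‖ ^ 2 := by
      rw [integral_mul_const, hgam, Real.rpow_neg hp.le, Real.rpow_mul hp.le, one_div,
        Real.inv_rpow (by positivity), Real.rpow_two]
      ring
    rw [e1, ofReal_integral_eq_lintegral_ofReal (hint.mul_const _)]
    · apply setLIntegral_congr_fun measurableSet_Ioi
      intro t _
      simp only
      congr 4
      ring
    · filter_upwards [ae_restrict_mem measurableSet_Ioi] with t ht
      have : (0 : ℝ) < t := ht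
      positivity
  rw [lintegral_congr_ae hptw, lintegral_lintegral_swap (Measurable.aemeasurable (by fun_prop))]
  rw [← Set.Ioc_union_Ioi_eq_Ioi (zero_le_one (α := ℝ)), lintegral_union measurableSet_Ioi
    (Set.Ioc_disjoint_Ioi le_rfl)]
  apply ENNReal.add_lt_top.2 ⟨?_, ?_⟩
  · have hi : IntegrableOn (fun t : ℝ => A * t ^ (s - 3/2)) (Set.Ioc 0 1) := by
      have := (intervalIntegral.intervalIntegrable_rpow' (a := 0) (b := 1) (r := s - 3/2)
        (by linarith)).const_mul A
      rwa [intervalIntegrable_iff_integrableOn_Ioc_of_le zero_le_one] at this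
    refine lt_of_le_of_lt (setLIntegral_mono' measurableSet_Ioc fun t ht => ?_) hi.2
    rw [hstep t ht.1]
    refine (ENNReal.ofReal_le_ofReal ?_).trans (Real.ofReal_le_enorm _)
    have ht0 : 0 < t := ht.1
    calc _ ≤ t ^ (s - 1) * (A * t ^ (-(1/2) : ℝ)) := by gcongr; exact (hAB t ht0).1
      _ = A * (t ^ (s - 1) * t ^ (-(1/2) : ℝ)) := by ring
      _ = _ := by rw [← Real.rpow_add ht0]; congr 2; ring
  · have hi : IntegrableOn (fun t : ℝ => B * t ^ (s - 1 - (n : ℝ)/2)) (Set.Ioi 1) := 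
      (integrableOn_Ioi_rpow_of_lt (by linarith) one_pos).const_mul B
    refine lt_of_le_of_lt (setLIntegral_mono' measurableSet_Ioi fun t ht => ?_) hi.2
    have ht0 : 0 < t := lt_trans one_pos ht
    rw [hstep t ht0]
    refine (ENNReal.ofReal_le_ofReal ?_).trans (Real.ofReal_le_enorm _)
    calc _ ≤ t ^ (s - 1) * (B * t ^ (-((n : ℝ) / 2))) := by gcongr; exact (hAB t ht0).2
      _ = B * (t ^ (s - 1) * t ^ (-((n : ℝ) / 2))) := by ring
      _ = _ := by rw [← Real.rpow_add ht0]; congr 2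

/-- averaged Fourier inversion -/
lemma avg_inversion {n : ℕ} (f : SchwartzMap (EuclideanSpace ℝ (Fin n)) ℂ)
    (hf : ∀ x y : EuclideanSpace ℝ (Fin n), ‖x‖ = ‖y‖ → f x = f y)
    (x : EuclideanSpace ℝ (Fin n)) :
    (sig n).real Set.univ * ‖f x‖ ≤
      ∫ ξ, ‖𝓕 (fun y => f y) ξ‖ * ‖charFun (sig n) ((2 * Real.pi * ‖x‖) • ξ)‖ := by
  have h1 : ((sig n).real Set.univ : ℂ) * f x = ∫ w, f (‖x‖ • w) ∂(sig n) := by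
    have : ∀ᵐ w ∂(sig n), f (‖x‖ • w) = f x := by
      filter_upwards [sig_ae n] with w hw
      apply hf
      simp [norm_smul, hw]
    rw [integral_congr_ae this, integral_const]
    simp
  have hFi : Integrable (fun ξ => (𝓕 f) ξ) := (𝓕 f).integrable
  have h2 : ∀ w, f (‖x‖ • w) = ∫ ξ : EuclideanSpace ℝ (Fin n),
      Complex.exp ((⟪w, (2 * Real.pi * ‖x‖) • ξ⟫ : ℝ) * Complex.I) * (𝓕 f) ξ := by
    intro w
    have h3 : f = 𝓕⁻ (𝓕 f) := (FourierTransform.fourierInv_fourier_eq f).symm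
    conv_lhs => rw [h3, SchwartzMap.fourierInv_coe, Real.fourierInv_eq']
    congr 1
    ext ξ
    rw [smul_eq_mul]
    congr 3
    rw [inner_smul_right, inner_smul_right, real_inner_comm]
    push_cast
    ring
  have hint : Integrable (fun p : EuclideanSpace ℝ (Fin n) × EuclideanSpace ℝ (Fin n) =>
      Complex.exp ((⟪p.1, (2 * Real.pi * ‖x‖) • p.2⟫ : ℝ) * Complex.I) * (𝓕 f) p.2)
      ((sig n).prod volume) := by
    have h3 := (integrable_const (1 : ℝ) (μ := sig n)).mul_prod hFi.norm
    refine h3.mono' ?_ (Filter.Eventually.of_forall fun p => ?_)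
    · apply Continuous.aestronglyMeasurable
      have := (𝓕 f).continuous
      fun_prop
    · rw [norm_mul, Complex.norm_exp_ofReal_mul_I]
  have h4 : ((sig n).real Set.univ : ℂ) * f x =
      ∫ ξ, charFun (sig n) ((2 * Real.pi * ‖x‖) • ξ) * (𝓕 f) ξ := by
    rw [h1]
    simp_rw [h2]
    rw [integral_integral_swap hint]
    congr 1
    ext ξ
    rw [integral_mul_const, charFun_apply]
  calc (sig n).real Set.univ * ‖f x‖ = ‖((sig n).real Set.univ : ℂ) * f x‖ := by
        rw [norm_mul, Complex.norm_real, Real.norm_eq_abs, abs_of_nonneg measureReal_nonneg]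
    _ ≤ _ := by
        rw [h4]
        refine (norm_integral_le_integral_norm _).trans (le_of_eq ?_)
        congr 1
        ext ξ
        rw [norm_mul, mul_comm]
        rfl

lemma schwartz_weight {n : ℕ} {s : ℝ} (hs0 : 0 < s) (hs2 : s < (n : ℝ) / 2)
    (g : SchwartzMap (EuclideanSpace ℝ (Fin n)) ℂ) :
    Integrable (fun ξ => ‖ξ‖ ^ (2 * s) * ‖g ξ‖ ^ 2) := by
  obtain ⟨M, hM⟩ : ∃ M, ∀ ξ, ‖g ξ‖ ≤ M := ⟨_, fun ξ => by
    simpa using SchwartzMap.le_seminorm ℝ 0 0 g ξ⟩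
  have h1 := ((g.integrable_pow_mul volume n).add (g.integrable_pow_mul volume 0)).mul_const M
  refine h1.mono' ?_ (Filter.Eventually.of_forall fun ξ => ?_)
  · apply Measurable.aestronglyMeasurable
    have := g.continuous.measurable
    fun_prop
  · rw [Real.norm_eq_abs, abs_of_nonneg (by positivity)]
    simp only [Pi.add_apply, pow_zero, one_mul]
    have h2 : ‖ξ‖ ^ (2 * s) ≤ ‖ξ‖ ^ n + 1 := by
      rcases le_total ‖ξ‖ 1 with h | h
      · have : ‖ξ‖ ^ (2 * s) ≤ 1 := Real.rpow_le_one (norm_nonneg _) h (by linarith)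
        have : 0 ≤ ‖ξ‖ ^ n := by positivity
        linarith
      · have : ‖ξ‖ ^ (2 * s) ≤ ‖ξ‖ ^ (n : ℝ) := Real.rpow_le_rpow_of_exponent_le h (by linarith)
        rw [Real.rpow_natCast] at this
        linarith
    calc _ = ‖ξ‖ ^ (2 * s) * ‖g ξ‖ * ‖g ξ‖ := by ring
      _ ≤ (‖ξ‖ ^ n + 1) * ‖g ξ‖ * M := by
        gcongr
        exact hM ξ
      _ = _ := by ring

end RadialTrace

open RadialTrace

set_option maxHeartbeats 1000000 in
/-- Radial trace (Strauss-type) estimate: for radial Schwartz `f` and `1/2 < s < n/2`,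
`|x|^{n/2-s} |f(x)| ≲ ‖f‖_{Ḣˢ}`. -/
theorem stmt_10 (n : ℕ) (hn : 2 ≤ n) (s : ℝ) (hs1 : 1 / 2 < s) (hs2 : s < (n : ℝ) / 2) :
    ∃ C > 0, ∀ f : SchwartzMap (EuclideanSpace ℝ (Fin n)) ℂ,
      (∀ x y : EuclideanSpace ℝ (Fin n), ‖x‖ = ‖y‖ → f x = f y) →
      ∀ x : EuclideanSpace ℝ (Fin n), x ≠ 0 →
        ‖x‖ ^ ((n : ℝ) / 2 - s) * ‖f x‖ ≤ C * homSobolevNorm n s (fun y => f y) := by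
  have hs0 : 0 < s := by linarith
  have : Nontrivial (EuclideanSpace ℝ (Fin n)) := by
    have : NeZero n := ⟨by omega⟩
    infer_instance
  have hM : 0 < (sig n).real Set.univ := by
    have h : (sig n) ≠ 0 := by
      rw [sig, Ne, Measure.map_eq_zero_iff (by fun_prop)]
      exact Measure.toSphere_ne_zero _
    have : NeZero (sig n) := ⟨h⟩
    exact measureReal_univ_pos
  set M := (sig n).real Set.univ with hMdef
  set W := ∫ ξ : EuclideanSpace ℝ (Fin n), ‖ξ‖ ^ (-(2 * s)) * ‖charFun (sig n) ξ‖ ^ 2 with hW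
  have hWi := weight_integrable hs1 hs2
  have hW0 : 0 ≤ W := integral_nonneg fun _ => by positivity
  have hp : 0 < 2 * Real.pi := by positivity
  refine ⟨M⁻¹ * ((2 * Real.pi) ^ (s - (n : ℝ) / 2) * W ^ ((1 : ℝ) / 2)) + 1, by positivity, ?_⟩
  intro f hf x hx
  have hx0 : 0 < ‖x‖ := norm_pos_iff.2 hx
  set c := 2 * Real.pi * ‖x‖ with hc
  have hc0 : 0 < c := by positivity
  have hcm : Measurable (fun ξ : EuclideanSpace ℝ (Fin n) => charFun (sig n) ξ) := measurable_charFun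
  -- scaling
  have hscale : ∀ ξ : EuclideanSpace ℝ (Fin n), (‖ξ‖ ^ (-s) * ‖charFun (sig n) (c • ξ)‖) ^ (2 : ℝ) =
      c ^ (2 * s) * (‖c • ξ‖ ^ (-(2 * s)) * ‖charFun (sig n) (c • ξ)‖ ^ 2) := by
    intro ξ
    rw [norm_smul, Real.norm_eq_abs, abs_of_pos hc0, Real.mul_rpow hc0.le (norm_nonneg _),
      ← mul_assoc, ← mul_assoc, ← Real.rpow_add hc0, add_neg_cancel, Real.rpow_zero, one_mul,
      Real.mul_rpow (by positivity) (by positivity), ← Real.rpow_mul (norm_nonneg _), Real.rpow_two]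
    congr 2
    ring
  have hWs : ∫ ξ : EuclideanSpace ℝ (Fin n), (‖ξ‖ ^ (-s) * ‖charFun (sig n) (c • ξ)‖) ^ (2 : ℝ) =
      c ^ (2 * s - n) * W := by
    simp_rw [hscale]
    rw [integral_const_mul, Measure.integral_comp_smul volume
      (fun ξ : EuclideanSpace ℝ (Fin n) => ‖ξ‖ ^ (-(2 * s)) * ‖charFun (sig n) ξ‖ ^ 2),
      finrank_euclideanSpace_fin, abs_of_pos (by positivity), smul_eq_mul, ← hW,
      Real.rpow_sub hc0, Real.rpow_natCast]
    ring
  have hFeq : ∀ ξ, (𝓕 f) ξ = 𝓕 (fun y => f y) ξ := fun ξ => rfl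
  have hFw := schwartz_weight hs0 hs2 (𝓕 f)
  have hFc : Measurable (fun ξ => (𝓕 f) ξ) := (𝓕 f).continuous.measurable
  have hsq1 : ∀ ξ : EuclideanSpace ℝ (Fin n), (‖ξ‖ ^ s * ‖(𝓕 f) ξ‖) ^ (2 : ℝ) =
      ‖ξ‖ ^ (2 * s) * ‖(𝓕 f) ξ‖ ^ 2 := by
    intro ξ
    rw [Real.mul_rpow (by positivity) (by positivity), ← Real.rpow_mul (norm_nonneg _),
      Real.rpow_two, mul_comm s]
  have hm1 : MemLp (fun ξ : EuclideanSpace ℝ (Fin n) => ‖ξ‖ ^ s * ‖(𝓕 f) ξ‖)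
      (ENNReal.ofReal 2) := by
    rw [ENNReal.ofReal_ofNat, memLp_two_iff_integrable_sq
      (Measurable.aestronglyMeasurable (by fun_prop))]
    refine hFw.congr (Filter.Eventually.of_forall fun ξ => ?_)
    simp only
    rw [← hsq1, Real.rpow_two]
  have hm2 : MemLp (fun ξ : EuclideanSpace ℝ (Fin n) => ‖ξ‖ ^ (-s) * ‖charFun (sig n) (c • ξ)‖)
      (ENNReal.ofReal 2) := by
    rw [ENNReal.ofReal_ofNat, memLp_two_iff_integrable_sq
      (Measurable.aestronglyMeasurable (by fun_prop))]
    refine ((hWi.comp_smul hc0.ne').const_mul (c ^ (2 * s))).congr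
      (Filter.Eventually.of_forall fun ξ => ?_)
    simp only
    rw [← hscale, Real.rpow_two]
  have hH := integral_mul_le_Lp_mul_Lq_of_nonneg (μ := volume) Real.HolderConjugate.two_two
    (Filter.Eventually.of_forall fun ξ => by positivity)
    (Filter.Eventually.of_forall fun ξ => by positivity) hm1 hm2
  simp_rw [hsq1] at hH
  rw [hWs] at hH
  have hav := avg_inversion f hf x
  have hae : ∀ᵐ ξ : EuclideanSpace ℝ (Fin n), ‖𝓕 (fun y => f y) ξ‖ * ‖charFun (sig n) (c • ξ)‖ =
      ‖ξ‖ ^ s * ‖(𝓕 f) ξ‖ * (‖ξ‖ ^ (-s) * ‖charFun (sig n) (c • ξ)‖) := by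
    have h0 : ∀ᵐ ξ : EuclideanSpace ℝ (Fin n), ξ ≠ 0 := by
      simp [ae_iff]
    filter_upwards [h0] with ξ hξ
    have hp : 0 < ‖ξ‖ := norm_pos_iff.2 hξ
    have : ‖ξ‖ ^ s * ‖ξ‖ ^ (-s) = 1 := by
      rw [← Real.rpow_add hp, add_neg_cancel, Real.rpow_zero]
    rw [← hFeq]
    linear_combination (-‖(𝓕 f) ξ‖ * ‖charFun (sig n) (c • ξ)‖) * this
  rw [integral_congr_ae hae] at hav
  have hfin := hav.trans hH
  have hN : (∫ ξ : EuclideanSpace ℝ (Fin n), ‖ξ‖ ^ (2 * s) * ‖(𝓕 f) ξ‖ ^ 2) ^ ((1 : ℝ) / 2) =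
    homSobolevNorm n s (fun y => f y) := rfl
  rw [hN, Real.mul_rpow (by positivity) hW0, ← Real.rpow_mul hc0.le] at hfin
  have hN0 : 0 ≤ homSobolevNorm n s (fun y => f y) := by
    rw [← hN]
    exact Real.rpow_nonneg (integral_nonneg fun ξ => by positivity) _
  have hexp : (2 * s - (n : ℝ)) * (1 / 2) = s - (n : ℝ) / 2 := by ring
  rw [hexp, hc, Real.mul_rpow hp.le hx0.le] at hfin
  set N := homSobolevNorm n s (fun y => f y)
  have hxx : ‖x‖ ^ ((n : ℝ) / 2 - s) * ‖x‖ ^ (s - (n : ℝ) / 2) = 1 := by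
    rw [← Real.rpow_add hx0]
    simp
  have hfx : ‖f x‖ ≤ M⁻¹ * (N * ((2 * Real.pi) ^ (s - (n : ℝ) / 2) * ‖x‖ ^ (s - (n : ℝ) / 2) *
      W ^ ((1 : ℝ) / 2))) := by
    rw [inv_mul_eq_div, le_div_iff₀ hM, mul_comm]
    exact hfin
  calc _ ≤ ‖x‖ ^ ((n : ℝ) / 2 - s) * (M⁻¹ * (N * ((2 * Real.pi) ^ (s - (n : ℝ) / 2) *
        ‖x‖ ^ (s - (n : ℝ) / 2) * W ^ ((1 : ℝ) / 2)))) := by gcongr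
    _ = (M⁻¹ * ((2 * Real.pi) ^ (s - (n : ℝ) / 2) * W ^ ((1 : ℝ) / 2))) * N := by
      linear_combination (M⁻¹ * N * (2 * Real.pi) ^ (s - (n : ℝ) / 2) * W ^ ((1 : ℝ) / 2)) * hxx
    _ ≤ _ := by nlinarith
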